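/- For every integer d ≥ 2 there exists a constant C > 0 such that for every n ∈ ℕ there is a finite family L_n of affine lines in ℝ^d with #L_n ≤ C^n and the following property: for every affine line ℓ that intersects [0,1]^d and is not contained in any dyadic hyperplane {x ∈ ℝ^d : x_j = m 2^{-n}} (j ∈ {1,…,d}, m ∈ ℤ), there exists ℓ' ∈ L_n such that ℋ¹(ℓ ∩ Q) ≤ ℋ¹(ℓ' ∩ Q) + C · 8^{-n} for every cube Q ∈ 𝒟_n. -/

import Mathlib

open MeasureTheory Metric Set
open scoped ENNReal NNReal

noncomputable section

/-- `ℝ^d` as Euclidean space. -/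
abbrev Pt (d : ℕ) := EuclideanSpace ℝ (Fin d)

/-- `L` is an affine line in `ℝ^d`. -/
def IsLine {d : ℕ} (L : Set (Pt d)) : Prop :=
  ∃ a v : Pt d, v ≠ 0 ∧ L = {x | ∃ t : ℝ, x = a + t • v}

/-- A tube of width `w` is the closed `w`-neighborhood of an affine line. -/
def IsTube {d : ℕ} (w : ℝ) (T : Set (Pt d)) : Prop :=
  ∃ L : Set (Pt d), IsLine L ∧ T = Metric.cthickening w L

/-- `A ⊆ ℝ^d` is tube null: for every `δ > 0` it is covered by countably many
tubes `T j` of widths `w j` with `∑ j, (w j)^(d-1) ≤ δ`. -/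
def TubeNull (d : ℕ) (A : Set (Pt d)) : Prop :=
  ∀ δ : ℝ, 0 < δ → ∃ (T : ℕ → Set (Pt d)) (w : ℕ → ℝ),
    (∀ n, 0 < w n ∧ IsTube (w n) (T n)) ∧ (A ⊆ ⋃ n, T n) ∧
    ∑' n, ENNReal.ofReal (w n) ^ (d - 1) ≤ ENNReal.ofReal δ

/-- The Hausdorff measure associated to the gauge function `h`. -/
def gMeasure {d : ℕ} (h : ℝ → ℝ) : Measure (Pt d) :=
  Measure.mkMetric (fun r : ℝ≥0∞ => ENNReal.ofReal (h r.toReal))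

/-- The closed dyadic cube of side length `2^{-n}` indexed by `m : Fin d → ℕ`. -/
def dyadicCube (d n : ℕ) (m : Fin d → ℕ) : Set (Pt d) :=
  {x | ∀ i, (m i : ℝ) * (2:ℝ) ^ (-(n:ℤ)) ≤ x i ∧ x i ≤ ((m i : ℝ) + 1) * (2:ℝ) ^ (-(n:ℤ))}

/-- `Q` is a closed dyadic sub-cube of `[0,1]^d` of side length `2^{-n}`. -/
def IsDyadicCube (d n : ℕ) (Q : Set (Pt d)) : Prop :=
  ∃ m : Fin d → ℕ, (∀ i, m i < 2 ^ n) ∧ Q = dyadicCube d n m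

/-- The closed unit cube of `ℝ^d`. -/
def unitCube (d : ℕ) : Set (Pt d) := {x | ∀ i, x i ∈ Set.Icc (0:ℝ) 1}

/-- The line through `a` with direction `v`. -/
def paramLine {d : ℕ} (a v : Pt d) : Set (Pt d) := {x | ∃ t : ℝ, x = a + t • v}

lemma hausdorffMeasure_paramLine_inter {d : ℕ} (a v : Pt d) (Q : Set (Pt d)) :
    μH[1] (paramLine a v ∩ Q) = ENNReal.ofReal ‖v‖ * volume {t : ℝ | a + t • v ∈ Q} := by
  have h : paramLine a v ∩ Q = AffineMap.lineMap a (a + v) '' {t : ℝ | a + t • v ∈ Q} := by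
    ext x
    simp only [paramLine, mem_inter_iff, mem_ofPred_eq, mem_image, AffineMap.lineMap_apply,
      vsub_eq_sub, add_sub_cancel_left, vadd_eq_add]
    constructor
    · rintro ⟨⟨t, rfl⟩, hx⟩
      exact ⟨t, hx, add_comm _ _⟩
    · rintro ⟨t, ht, rfl⟩
      exact ⟨⟨t, add_comm _ _⟩, by rwa [add_comm]⟩
  rw [h, hausdorffMeasure_lineMap_image, hausdorffMeasure_real, ENNReal.smul_def, smul_eq_mul]
  congr 1
  simp [nndist_eq_nnnorm, enorm_eq_nnnorm]

/-- Every line has a parametrization whose direction has maximal coordinate `1`. -/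
lemma IsLine.exists_normalized {d : ℕ} {l : Set (Pt d)} (hl : IsLine l) :
    ∃ (i : Fin d) (a v : Pt d), a i = 0 ∧ v i = 1 ∧ (∀ j, |v j| ≤ 1) ∧ l = paramLine a v := by
  obtain ⟨a, v, hv, rfl⟩ := hl
  obtain ⟨k, hk⟩ : ∃ k, v k ≠ 0 := by
    by_contra! h
    exact hv (by ext k; simpa using h k)
  obtain ⟨i, -, hi⟩ := Finset.exists_max_image Finset.univ (fun j => |v j|) ⟨k, Finset.mem_univ k⟩
  have hi0 : v i ≠ 0 := by
    have := hi k (Finset.mem_univ k)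
    exact abs_pos.1 (lt_of_lt_of_le (abs_pos.2 hk) this)
  refine ⟨i, a - (a i / v i) • v, (v i)⁻¹ • v, ?_, ?_, ?_, ?_⟩
  · simp [hi0]
  · simp [hi0]
  · intro j
    have := hi j (Finset.mem_univ j)
    simp only [PiLp.smul_apply, smul_eq_mul, abs_mul, abs_inv]
    rw [inv_mul_le_iff₀ (abs_pos.2 hi0)]
    simpa using this
  · ext x
    simp only [paramLine, mem_ofPred_eq]
    constructor
    · rintro ⟨t, rfl⟩
      refine ⟨v i * t + a i, ?_⟩
      rw [smul_smul, sub_add, ← sub_smul, sub_eq_add_neg, ← neg_smul]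
      congr 2
      field_simp
      ring
    · rintro ⟨t, rfl⟩
      refine ⟨t / v i - a i / v i, ?_⟩
      rw [smul_smul, sub_smul, div_eq_mul_inv t]
      abel

/-- The parameters in `[0,1]` at which `t ↦ a + s t` lies in the grid interval `[m/N, (m+1)/N]`
but `t ↦ a' + s' t` does not. -/
def badSet (N a s a' s' : ℝ) (m : ℤ) : Set ℝ :=
  {t | t ∈ Icc (0 : ℝ) 1 ∧ (m ≤ N * (a + s * t) ∧ N * (a + s * t) ≤ m + 1) ∧
    ¬ (m ≤ N * (a' + s' * t) ∧ N * (a' + s' * t) ≤ m + 1)}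

lemma badSet_neg (N a s a' s' : ℝ) (m : ℤ) :
    badSet N (-a) (-s) (-a') (-s') (-m - 1) = badSet N a s a' s' m := by
  ext t
  have h : ∀ b r : ℝ, (((-m - 1 : ℤ) : ℝ) ≤ N * (-b + -r * t) ∧
      N * (-b + -r * t) ≤ ((-m - 1 : ℤ) : ℝ) + 1) ↔
      ((m : ℝ) ≤ N * (b + r * t) ∧ N * (b + r * t) ≤ m + 1) := by
    intro b r
    push_cast
    constructor <;> rintro ⟨h1, h2⟩ <;> constructor <;> linarith
  simp only [badSet, mem_ofPred_eq, h]

lemma volume_badSet_le_of_close {M N a s a' s' : ℝ} (hM : 0 < M) (hN : 0 < N) (hs : 1 ≤ N * |s|)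
    (ha' : |a' - a| ≤ 1 / (N * M)) (hs' : |s' - s| ≤ 1 / (N * M)) (m : ℤ) :
    volume (badSet N a s a' s' m) ≤ ENNReal.ofReal (8 / M) := by
  have hs0 : s ≠ 0 := by
    rintro rfl
    norm_num at hs
  have key : ∀ c t : ℝ, |N * (a + s * t) - c| ≤ 2 / M →
      t ∈ closedBall ((c / N - a) / s) (2 / M) := by
    intro c t h
    rw [mem_closedBall, Real.dist_eq]
    have e : N * (a + s * t) - c = N * s * (t - (c / N - a) / s) := by
      field_simp
      ring
    rw [e, abs_mul, abs_mul, abs_of_pos hN] at h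
    exact (le_mul_of_one_le_left (abs_nonneg _) hs).trans h
  have hsub : badSet N a s a' s' m ⊆ closedBall (((m : ℝ) / N - a) / s) (2 / M) ∪
      closedBall ((((m : ℝ) + 1) / N - a) / s) (2 / M) := by
    rintro t ⟨⟨h0, h1⟩, ⟨h2, h3⟩, h4⟩
    have hd : |N * (a' + s' * t) - N * (a + s * t)| ≤ 2 / M := by
      have e : N * (a' + s' * t) - N * (a + s * t) = N * ((a' - a) + (s' - s) * t) := by ring
      have h5 : |(s' - s) * t| ≤ 1 / (N * M) := by
        rw [abs_mul, abs_of_nonneg h0]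
        exact (mul_le_of_le_one_right (abs_nonneg _) h1).trans hs'
      have h6 : |(a' - a) + (s' - s) * t| ≤ 2 / (N * M) := by
        calc _ ≤ _ := abs_add_le _ _
          _ ≤ 1 / (N * M) + 1 / (N * M) := add_le_add ha' h5
          _ = _ := by ring
      rw [e, abs_mul, abs_of_pos hN]
      calc _ ≤ N * (2 / (N * M)) := by gcongr
        _ = _ := by field_simp
    rw [abs_le] at hd
    rcases not_and_or.1 h4 with h | h
    · exact Or.inl (key _ _ (abs_le.2 ⟨by linarith, by linarith⟩))
    · exact Or.inr (key _ _ (abs_le.2 ⟨by linarith, by linarith⟩))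
  calc _ ≤ _ := measure_mono hsub
    _ ≤ _ := measure_union_le _ _
    _ = ENNReal.ofReal (8 / M) := by
      rw [Real.volume_closedBall, Real.volume_closedBall,
        ← ENNReal.ofReal_add (by positivity) (by positivity)]
      congr 1
      ring

lemma badSet_subset_zero {N a s : ℝ} {k : ℤ} (hs : 0 ≤ s) (hN : 0 < N)
    (ha : k ≤ N * a) (hk : N * (a + s) < k + 1) (h : ¬ (s = 0 ∧ N * a = k)) (m : ℤ) :
    badSet N a s (k / N) (1 / N) m ⊆ {0} := by
  rintro t ⟨⟨h0, h1⟩, ⟨h2, h3⟩, h4⟩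
  have e : N * ((k : ℝ) / N + 1 / N * t) = k + t := by field_simp
  rw [e] at h4
  have hst : 0 ≤ N * (s * t) := by positivity
  have hst' : N * (s * t) ≤ N * s := by
    gcongr
    exact mul_le_of_le_one_right hs h1
  rw [mul_add] at h2 h3 hk
  have hm1 : m ≤ k := by
    have : (m : ℝ) < k + 1 := by linarith
    exact Int.lt_add_one_iff.1 (by exact_mod_cast this)
  have hm2 : k ≤ m + 1 := by
    have : (k : ℝ) ≤ m + 1 := by linarith
    exact_mod_cast this
  have hm3 : m ≠ k := by
    rintro rfl
    exact h4 ⟨by linarith, by linarith⟩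
  have hm4 : (k : ℝ) = m + 1 := by
    have : k = m + 1 := by omega
    exact_mod_cast this
  have h5 : N * (s * t) = 0 := by linarith
  have h6 : N * a = k := by linarith
  have h7 : s ≠ 0 := fun h' => h ⟨h', h6⟩
  simpa [hN.ne', h7] using h5

lemma badSet_subset_Icc {N a s t₀ t₁ : ℝ} {k : ℤ} (hs : 0 < s) (hN : 0 < N) (hs1 : N * s < 1)
    (h₀ : t₀ ≤ 1) (h₁ : 0 ≤ t₁) (h₁₀ : t₁ ≤ t₀) (hk : N * (a + s * t₀) = k) (m : ℤ) :
    badSet N a s ((k - t₁) / N) (1 / N) m ⊆ Icc t₁ t₀ := by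
  rintro t ⟨⟨h0, h1⟩, ⟨h2, h3⟩, h4⟩
  have e : N * ((k - t₁) / N + 1 / N * t) = k + (t - t₁) := by
    field_simp
    ring
  have e' : N * (a + s * t) = k + N * s * (t - t₀) := by
    rw [← hk]
    ring
  rw [e] at h4
  rw [e'] at h2 h3
  have hNs : 0 < N * s := by positivity
  by_contra hout
  rcases lt_or_ge t₀ t with hlt | hge
  · have p1 : 0 < N * s * (t - t₀) := by
      have : 0 < t - t₀ := by linarith
      positivity
    have p2 : N * s * (t - t₀) < 1 := by nlinarith
    have hm1 : m ≤ k := by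
      have : (m : ℝ) < k + 1 := by linarith
      exact Int.lt_add_one_iff.1 (by exact_mod_cast this)
    have hm2 : k ≤ m := by
      have : (k : ℝ) < m + 1 := by linarith
      exact Int.lt_add_one_iff.1 (by exact_mod_cast this)
    obtain rfl : m = k := le_antisymm hm1 hm2
    exact h4 ⟨by linarith, by linarith⟩
  · have hlt : t < t₁ := by
      by_contra hcon
      exact hout ⟨not_lt.1 hcon, hge⟩
    have p1 : 0 < N * s * (t₀ - t) := by
      have : 0 < t₀ - t := by linarith
      positivity
    have p2 : N * s * (t₀ - t) < 1 := by nlinarith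
    have hm1 : m < k := by
      have : (m : ℝ) < k := by nlinarith
      exact_mod_cast this
    have hm2 : k ≤ m + 1 := by
      have : (k : ℝ) < m + 1 + 1 := by nlinarith
      exact Int.lt_add_one_iff.1 (by exact_mod_cast this)
    have hm3 : (k : ℝ) = m + 1 := by
      have : k = m + 1 := by omega
      exact_mod_cast this
    exact h4 ⟨by linarith, by linarith⟩

lemma exists_grid_approx_of_nonneg {N : ℕ} (hN : 0 < N) {a s : ℝ} (ha : |a| ≤ 2) (hs0 : 0 ≤ s)
    (hs1 : s ≤ 1) (h : ¬ (s = 0 ∧ ∃ k : ℤ, N * a = k)) :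
    ∃ p q : ℤ, |p| ≤ 4 * (N : ℤ) ^ 4 ∧ |q| ≤ 4 * (N : ℤ) ^ 4 ∧
      |s| ≤ |(q : ℝ) / (N : ℝ) ^ 4| ∧
      ∀ m : ℤ, volume (badSet N a s (p / (N : ℝ) ^ 4) (q / (N : ℝ) ^ 4) m) ≤
        ENNReal.ofReal (8 / (N : ℝ) ^ 3) := by
  have hN1 : (1 : ℝ) ≤ N := by exact_mod_cast hN
  have hN0 : (0 : ℝ) < N := by linarith
  have hN4 : (1 : ℝ) ≤ (N : ℝ) ^ 4 := one_le_pow₀ hN1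
  have hN3 : (1 : ℝ) ≤ (N : ℝ) ^ 3 := one_le_pow₀ hN1
  have hN34 : (N : ℝ) ^ 3 ≤ (N : ℝ) ^ 4 := pow_le_pow_right₀ hN1 (by norm_num)
  have habs : ∀ z : ℤ, |(z : ℝ)| ≤ 4 * (N : ℝ) ^ 4 → |z| ≤ 4 * (N : ℤ) ^ 4 := by
    intro z hz
    exact_mod_cast hz
  rw [abs_le] at ha
  rcases le_or_gt 1 (N * s) with hbig | hsmall
  · have hq1 := Int.le_ceil (s * (N : ℝ) ^ 4)
    have hq2 := Int.ceil_lt_add_one (s * (N : ℝ) ^ 4)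
    have hp1 := Int.floor_le (a * (N : ℝ) ^ 4)
    have hp2 := Int.lt_floor_add_one (a * (N : ℝ) ^ 4)
    have hsN : 0 ≤ s * (N : ℝ) ^ 4 := by positivity
    have hN4' : (N : ℝ) * (N : ℝ) ^ 3 = (N : ℝ) ^ 4 := by ring
    refine ⟨⌊a * (N : ℝ) ^ 4⌋, ⌈s * (N : ℝ) ^ 4⌉, habs _ ?_, habs _ ?_, ?_, fun m =>
      volume_badSet_le_of_close (by positivity) hN0 (by rwa [abs_of_nonneg hs0]) ?_ ?_ m⟩
    · rw [abs_le]
      constructor <;> nlinarith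
    · rw [abs_le]
      constructor <;> nlinarith
    · rw [abs_of_nonneg hs0]
      exact le_trans ((le_div_iff₀ (by positivity)).2 hq1) (le_abs_self _)
    · rw [hN4', show (⌊a * (N : ℝ) ^ 4⌋ : ℝ) / (N : ℝ) ^ 4 - a =
        (⌊a * (N : ℝ) ^ 4⌋ - a * (N : ℝ) ^ 4) / (N : ℝ) ^ 4 by field_simp, abs_div,
        abs_of_pos (by positivity : (0 : ℝ) < (N : ℝ) ^ 4)]
      gcongr
      rw [abs_le]
      constructor <;> linarith
    · rw [hN4', show (⌈s * (N : ℝ) ^ 4⌉ : ℝ) / (N : ℝ) ^ 4 - s =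
        (⌈s * (N : ℝ) ^ 4⌉ - s * (N : ℝ) ^ 4) / (N : ℝ) ^ 4 by field_simp, abs_div,
        abs_of_pos (by positivity : (0 : ℝ) < (N : ℝ) ^ 4)]
      gcongr
      rw [abs_le]
      constructor <;> linarith
  · have hslope : (((N : ℤ) ^ 3 : ℤ) : ℝ) / (N : ℝ) ^ 4 = 1 / N := by
      push_cast
      field_simp
    have hslope_le : |s| ≤ |(((N : ℤ) ^ 3 : ℤ) : ℝ) / (N : ℝ) ^ 4| := by
      rw [hslope, abs_of_nonneg hs0, abs_of_pos (by positivity), le_div_iff₀ hN0]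
      linarith
    have hq : |(((N : ℤ) ^ 3 : ℤ) : ℝ)| ≤ 4 * (N : ℝ) ^ 4 := by
      push_cast
      rw [abs_of_pos (by positivity)]
      linarith
    have hk1 := Int.floor_le (N * a)
    have hk2 := Int.lt_floor_add_one (N * a)
    set k : ℤ := ⌊N * a⌋ with hk
    have hkN1 : (k : ℝ) * (N : ℝ) ^ 3 ≤ 2 * (N : ℝ) ^ 4 := by
      calc (k : ℝ) * (N : ℝ) ^ 3 ≤ (N * a) * (N : ℝ) ^ 3 := by gcongr
        _ = a * (N : ℝ) ^ 4 := by ring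
        _ ≤ _ := by gcongr; exact ha.2
    have hkN2 : -2 * (N : ℝ) ^ 4 ≤ ((k : ℝ) + 1) * (N : ℝ) ^ 3 := by
      calc -2 * (N : ℝ) ^ 4 ≤ a * (N : ℝ) ^ 4 := by gcongr; linarith [ha.1]
        _ = (N * a) * (N : ℝ) ^ 3 := by ring
        _ ≤ _ := by gcongr
    rcases lt_or_ge (N * (a + s)) (k + 1) with hno | hcross
    · refine ⟨k * (N : ℤ) ^ 3, (N : ℤ) ^ 3, habs _ ?_, habs _ hq, hslope_le, fun m => ?_⟩
      · push_cast
        rw [abs_le]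
        constructor <;> nlinarith
      · have e : ((k * (N : ℤ) ^ 3 : ℤ) : ℝ) / (N : ℝ) ^ 4 = k / N := by
          push_cast
          field_simp
        rw [hslope, e]
        refine (measure_mono (badSet_subset_zero hs0 hN0 hk1 hno ?_ m)).trans (by simp)
        rintro ⟨h1, h2⟩
        exact h ⟨h1, k, h2⟩
    · have hs : 0 < s := by
        rcases hs0.eq_or_lt with h0 | h0
        · rw [← h0, add_zero] at hcross
          linarith
        · exact h0
      have hNs : 0 < N * s := by positivity
      set t₀ : ℝ := (k + 1 - N * a) / (N * s) with ht₀
      have ht₀1 : t₀ ≤ 1 := by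
        rw [ht₀, div_le_one hNs]
        linarith
      have ht₀0 : 0 ≤ t₀ := div_nonneg (by linarith) hNs.le
      have hf1 := Int.floor_le (t₀ * (N : ℝ) ^ 3)
      have hf2 := Int.lt_floor_add_one (t₀ * (N : ℝ) ^ 3)
      have hf0 : (0 : ℝ) ≤ (⌊t₀ * (N : ℝ) ^ 3⌋ : ℝ) := by
        exact_mod_cast Int.floor_nonneg.2 (by positivity)
      have hf3 : t₀ * (N : ℝ) ^ 3 ≤ (N : ℝ) ^ 3 := mul_le_of_le_one_left (by positivity) ht₀1
      set r : ℤ := ⌊t₀ * (N : ℝ) ^ 3⌋ with hr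
      refine ⟨(k + 1) * (N : ℤ) ^ 3 - r, (N : ℤ) ^ 3, habs _ ?_, habs _ hq, hslope_le,
        fun m => ?_⟩
      · push_cast
        rw [abs_le]
        constructor <;> nlinarith
      · have e : (((k + 1) * (N : ℤ) ^ 3 - r : ℤ) : ℝ) / (N : ℝ) ^ 4 =
            (((k + 1 : ℤ) : ℝ) - r / (N : ℝ) ^ 3) / N := by
          push_cast
          field_simp
        rw [hslope, e]
        refine (measure_mono (badSet_subset_Icc hs hN0 hsmall ht₀1
          (t₁ := r / (N : ℝ) ^ 3) (by positivity) ?_ ?_ m)).trans ?_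
        · rwa [div_le_iff₀ (by positivity)]
        · rw [ht₀]
          push_cast
          field_simp
          ring
        · rw [Real.volume_Icc]
          apply ENNReal.ofReal_le_ofReal
          rw [le_div_iff₀ (by positivity), sub_mul, div_mul_cancel₀ _ (by positivity)]
          linarith

/-- A non-degenerate affine function on `[0,1]` is approximated, up to a set of parameters of
measure `8 / N ^ 3`, by one with coefficients in a finite grid and with a steeper slope. -/
lemma exists_grid_approx {N : ℕ} (hN : 0 < N) {a s : ℝ} (ha : |a| ≤ 2) (hs : |s| ≤ 1)
    (h : ¬ (s = 0 ∧ ∃ k : ℤ, N * a = k)) :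
    ∃ p q : ℤ, |p| ≤ 4 * (N : ℤ) ^ 4 ∧ |q| ≤ 4 * (N : ℤ) ^ 4 ∧
      |s| ≤ |(q : ℝ) / (N : ℝ) ^ 4| ∧
      ∀ m : ℤ, volume (badSet N a s (p / (N : ℝ) ^ 4) (q / (N : ℝ) ^ 4) m) ≤
        ENNReal.ofReal (8 / (N : ℝ) ^ 3) := by
  rcases le_total 0 s with h0 | h0
  · exact exists_grid_approx_of_nonneg hN ha h0 (abs_le.1 hs).2 h
  · obtain ⟨p, q, hp, hq, hsq, hm⟩ := exists_grid_approx_of_nonneg hN (a := -a) (s := -s)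
      (by rwa [abs_neg]) (by linarith) (by linarith [(abs_le.1 hs).1]) (by
        rintro ⟨h1, k, hk⟩
        exact h ⟨by linarith, -k, by push_cast; linarith⟩)
    refine ⟨-p, -q, by rwa [abs_neg], by rwa [abs_neg], ?_, fun m => ?_⟩
    · push_cast
      rwa [neg_div, abs_neg, ← abs_neg s]
    · rw [← badSet_neg]
      push_cast
      rw [neg_div, neg_div, neg_neg, neg_neg]
      exact hm _

lemma norm_le_norm_of_abs_le {d : ℕ} {v w : Pt d} (h : ∀ j, |v j| ≤ |w j|) : ‖v‖ ≤ ‖w‖ := by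
  rw [EuclideanSpace.norm_eq, EuclideanSpace.norm_eq]
  gcongr with j
  exact h j

lemma norm_le_of_abs_le_one {d : ℕ} {v : Pt d} (h : ∀ j, |v j| ≤ 1) : ‖v‖ ≤ d := by
  rw [EuclideanSpace.norm_eq, Real.sqrt_le_left (by positivity)]
  calc ∑ j, ‖v j‖ ^ 2 ≤ ∑ _j : Fin d, (1 : ℝ) := by
        gcongr with j
        exact pow_le_one₀ (norm_nonneg _) (h j)
    _ = d := by simp
    _ ≤ (d : ℝ) ^ 2 := by
        exact_mod_cast Nat.le_self_pow two_ne_zero d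

lemma mem_dyadicCube_iff {d n : ℕ} {m : Fin d → ℕ} {x : Pt d} :
    x ∈ dyadicCube d n m ↔
      ∀ j, ((m j : ℤ) : ℝ) ≤ ((2 ^ n : ℕ) : ℝ) * x j ∧
        ((2 ^ n : ℕ) : ℝ) * x j ≤ ((m j : ℤ) : ℝ) + 1 := by
  have h2 : (0 : ℝ) < 2 ^ n := by positivity
  simp only [dyadicCube, mem_ofPred_eq, zpow_neg, zpow_natCast, ← div_eq_mul_inv,
    div_le_iff₀ h2, le_div_iff₀ h2, Int.cast_natCast, Nat.cast_pow, Nat.cast_ofNat]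
  simp only [mul_comm]

lemma dyadicCube_subset_unitCube {d n : ℕ} {m : Fin d → ℕ} (hm : ∀ i, m i < 2 ^ n) :
    dyadicCube d n m ⊆ unitCube d := by
  intro x hx i
  obtain ⟨h1, h2⟩ := mem_dyadicCube_iff.1 hx i
  have h3 : ((m i : ℤ) : ℝ) + 1 ≤ ((2 ^ n : ℕ) : ℝ) := by exact_mod_cast hm i
  have h4 : (0 : ℝ) ≤ ((m i : ℤ) : ℝ) := by positivity
  have h5 : (0 : ℝ) < ((2 ^ n : ℕ) : ℝ) := by positivity
  constructor
  · exact nonneg_of_mul_nonneg_right (h4.trans h1) h5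
  · exact le_of_mul_le_mul_left (by linarith) h5

lemma volume_param_le {d : ℕ} {i : Fin d} {a v a' v' : Pt d} {n : ℕ} {m : Fin d → ℕ}
    (hm : ∀ i, m i < 2 ^ n) (hai : a i = 0) (hvi : v i = 1) {ε : ℝ≥0∞}
    (h : ∀ j, volume (badSet (2 ^ n : ℕ) (a j) (v j) (a' j) (v' j) (m j)) ≤ ε) :
    volume {t : ℝ | a + t • v ∈ dyadicCube d n m} ≤
      volume {t : ℝ | a' + t • v' ∈ dyadicCube d n m} + d * ε := by
  have hsub : {t : ℝ | a + t • v ∈ dyadicCube d n m} ⊆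
      {t : ℝ | a' + t • v' ∈ dyadicCube d n m} ∪
        ⋃ j, badSet (2 ^ n : ℕ) (a j) (v j) (a' j) (v' j) (m j) := by
    intro t ht
    have ht01 : t ∈ Icc (0 : ℝ) 1 := by
      simpa [hai, hvi] using dyadicCube_subset_unitCube hm ht i
    by_cases ht' : a' + t • v' ∈ dyadicCube d n m
    · exact Or.inl ht'
    · right
      obtain ⟨j, hj⟩ := not_forall.1 (mt mem_dyadicCube_iff.2 ht')
      refine mem_iUnion.2 ⟨j, ht01, ?_, ?_⟩
      · simpa only [PiLp.add_apply, PiLp.smul_apply, smul_eq_mul, mul_comm t] using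
          mem_dyadicCube_iff.1 ht j
      · simpa only [PiLp.add_apply, PiLp.smul_apply, smul_eq_mul, mul_comm t] using hj
  calc _ ≤ _ := measure_mono hsub
    _ ≤ _ := measure_union_le _ _
    _ ≤ _ := by
      gcongr
      calc _ ≤ ∑ j, volume (badSet (2 ^ n : ℕ) (a j) (v j) (a' j) (v' j) (m j)) :=
            measure_iUnion_fintype_le _ _
        _ ≤ ∑ _j : Fin d, ε := by
            gcongr with j
            exact h j
        _ = d * ε := by simp

lemma hausdorffMeasure_inter_le {d : ℕ} {i : Fin d} {a v a' v' : Pt d} {n : ℕ} {m : Fin d → ℕ}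
    (hm : ∀ i, m i < 2 ^ n) (hai : a i = 0) (hvi : v i = 1) (hv : ∀ j, |v j| ≤ 1)
    (hv' : ∀ j, |v j| ≤ |v' j|) {ε : ℝ}
    (h : ∀ j, volume (badSet (2 ^ n : ℕ) (a j) (v j) (a' j) (v' j) (m j)) ≤ ENNReal.ofReal ε) :
    μH[1] (paramLine a v ∩ dyadicCube d n m) ≤
      μH[1] (paramLine a' v' ∩ dyadicCube d n m) + ENNReal.ofReal ((d : ℝ) ^ 2 * ε) := by
  rw [hausdorffMeasure_paramLine_inter, hausdorffMeasure_paramLine_inter]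
  calc _ ≤ ENNReal.ofReal ‖v‖ *
        (volume {t : ℝ | a' + t • v' ∈ dyadicCube d n m} + d * ENNReal.ofReal ε) := by
        gcongr
        exact volume_param_le hm hai hvi h
    _ = ENNReal.ofReal ‖v‖ * volume {t : ℝ | a' + t • v' ∈ dyadicCube d n m} +
        ENNReal.ofReal ‖v‖ * (d * ENNReal.ofReal ε) := mul_add _ _ _
    _ ≤ ENNReal.ofReal ‖v'‖ * volume {t : ℝ | a' + t • v' ∈ dyadicCube d n m} +
        ENNReal.ofReal d * (ENNReal.ofReal d * ENNReal.ofReal ε) := by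
        rw [ENNReal.ofReal_natCast]
        gcongr
        · exact norm_le_norm_of_abs_le hv'
        · rw [← ENNReal.ofReal_natCast]
          exact ENNReal.ofReal_le_ofReal (norm_le_of_abs_le_one hv)
    _ = _ := by
        rw [← ENNReal.ofReal_mul (by positivity), ← ENNReal.ofReal_mul (by positivity)]
        congr 2
        ring

/-- The point whose coordinates are `p j / 2 ^ (4 n)`. -/
def gridPt {d : ℕ} (n : ℕ) (p : Fin d → ℤ) : Pt d :=
  WithLp.toLp 2 fun j => (p j : ℝ) / ((2 ^ n : ℕ) : ℝ) ^ 4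

/-- Integer vectors with coordinates bounded by `4 * 2 ^ (4 n)`. -/
def gridIndex (d n : ℕ) : Finset (Fin d → ℤ) :=
  Fintype.piFinset fun _ =>
    Finset.Icc (-(4 * ((2 ^ n : ℕ) : ℤ) ^ 4)) (4 * ((2 ^ n : ℕ) : ℤ) ^ 4)

open Classical in
/-- Lines with base point and direction in the grid. -/
def gridLines (d n : ℕ) : Finset (Set (Pt d)) :=
  ((gridIndex d n ×ˢ gridIndex d n).filter fun pq => gridPt n pq.2 ≠ 0).image
    fun pq => paramLine (gridPt n pq.1) (gridPt n pq.2)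

lemma card_gridIndex_le (d : ℕ) {n : ℕ} (hn : n ≠ 0) : (gridIndex d n).card ≤ (144 ^ d) ^ n := by
  have hc : (4 * ((2 ^ n : ℕ) : ℤ) ^ 4 + 1 - -(4 * ((2 ^ n : ℕ) : ℤ) ^ 4)).toNat =
      8 * 16 ^ n + 1 := by
    have : ((2 ^ n : ℕ) : ℤ) ^ 4 = ((16 ^ n : ℕ) : ℤ) := by
      push_cast
      rw [← pow_mul, mul_comm, pow_mul]
      norm_num
    rw [this]
    omega
  rw [gridIndex, Fintype.card_piFinset_const, Int.card_Icc, hc, ← pow_mul, mul_comm d n, pow_mul]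
  gcongr
  calc 8 * 16 ^ n + 1 ≤ 9 * 16 ^ n := by linarith [Nat.one_le_pow n 16 (by norm_num)]
    _ ≤ 9 ^ n * 16 ^ n := by
      gcongr
      exact Nat.le_self_pow hn 9
    _ = 144 ^ n := by norm_num [← mul_pow]

lemma card_gridLines_le (d : ℕ) {n : ℕ} (hn : n ≠ 0) :
    (gridLines d n).card ≤ (144 ^ d * 144 ^ d) ^ n := by
  classical
  refine Finset.card_image_le.trans ((Finset.card_filter_le _ _).trans ?_)
  rw [Finset.card_product, mul_pow]
  exact Nat.mul_le_mul (card_gridIndex_le d hn) (card_gridIndex_le d hn)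

lemma isLine_of_mem_gridLines {d n : ℕ} {l : Set (Pt d)} (hl : l ∈ gridLines d n) : IsLine l := by
  classical
  obtain ⟨pq, hpq, rfl⟩ := Finset.mem_image.1 hl
  exact ⟨_, _, (Finset.mem_filter.1 hpq).2, rfl⟩

lemma exists_mem_gridLines {d : ℕ} (n : ℕ) {i : Fin d} {a v : Pt d} (hai : a i = 0)
    (hvi : v i = 1) (hv : ∀ j, |v j| ≤ 1) (hne : (paramLine a v ∩ unitCube d).Nonempty)
    (h : ¬ ∃ (j : Fin d) (m : ℤ),
      paramLine a v ⊆ {x : Pt d | x j = (m : ℝ) * (2 : ℝ) ^ (-(n : ℤ))}) :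
    ∃ l' ∈ gridLines d n, ∀ Q : Set (Pt d), IsDyadicCube d n Q →
      μH[1] (paramLine a v ∩ Q) ≤
        μH[1] (l' ∩ Q) + ENNReal.ofReal (8 * (d : ℝ) ^ 2 * (8 : ℝ) ^ (-(n : ℤ))) := by
  classical
  have ha : ∀ j, |a j| ≤ 2 := by
    obtain ⟨x, ⟨t, rfl⟩, hx⟩ := hne
    have ht : t ∈ Icc (0 : ℝ) 1 := by simpa [hai, hvi] using hx i
    intro j
    have hj := hx j
    simp only [PiLp.add_apply, PiLp.smul_apply, smul_eq_mul, mem_Icc] at hj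
    have h1 : |t * v j| ≤ 1 := by
      rw [abs_mul, abs_of_nonneg ht.1]
      exact mul_le_one₀ ht.2 (abs_nonneg _) (hv j)
    rw [abs_le] at h1 ⊢
    constructor <;> linarith
  have hdeg : ∀ j, ¬ (v j = 0 ∧ ∃ k : ℤ, ((2 ^ n : ℕ) : ℝ) * a j = k) := by
    rintro j ⟨hj, k, hk⟩
    refine h ⟨j, k, ?_⟩
    rintro x ⟨t, rfl⟩
    simp only [mem_ofPred_eq, PiLp.add_apply, PiLp.smul_apply, smul_eq_mul, hj, mul_zero, add_zero,
      ← hk, zpow_neg, zpow_natCast]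
    push_cast
    field_simp
  choose p q hp hq hpq hbad using fun j =>
    exists_grid_approx (N := 2 ^ n) (by positivity) (ha j) (hv j) (hdeg j)
  refine ⟨paramLine (gridPt n p) (gridPt n q), ?_, ?_⟩
  · refine Finset.mem_image.2 ⟨(p, q), Finset.mem_filter.2 ⟨Finset.mem_product.2 ⟨?_, ?_⟩, ?_⟩, rfl⟩
    · exact Fintype.mem_piFinset.2 fun j => Finset.mem_Icc.2 (abs_le.1 (hp j))
    · exact Fintype.mem_piFinset.2 fun j => Finset.mem_Icc.2 (abs_le.1 (hq j))
    · intro h0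
      have h1 : (q i : ℝ) / ((2 ^ n : ℕ) : ℝ) ^ 4 = 0 := congrArg (fun x : Pt d => x i) h0
      have h2 := hpq i
      rw [h1, hvi] at h2
      norm_num at h2
  · rintro Q ⟨m, hm, rfl⟩
    have := hausdorffMeasure_inter_le (a' := gridPt n p) (v' := gridPt n q) hm hai hvi hv hpq
      fun j => hbad j (m j)
    convert this using 3
    rw [zpow_neg, zpow_natCast, Nat.cast_pow, ← pow_mul, mul_comm n 3, pow_mul]
    push_cast
    norm_num
    ring

lemma hausdorffMeasure_inter_unitCube_le {d : ℕ} {l Q : Set (Pt d)} (hl : IsLine l)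
    (hQ : Q ⊆ unitCube d) : μH[1] (l ∩ Q) ≤ ENNReal.ofReal d := by
  obtain ⟨i, a, v, hai, hvi, hv, rfl⟩ := hl.exists_normalized
  rw [hausdorffMeasure_paramLine_inter]
  have hsub : {t : ℝ | a + t • v ∈ Q} ⊆ Icc 0 1 := by
    intro t ht
    simpa [hai, hvi] using hQ ht i
  calc _ ≤ ENNReal.ofReal d * volume (Icc (0 : ℝ) 1) := by
        gcongr
        exact norm_le_of_abs_le_one hv
    _ = _ := by simp

/-- Lemma 3.3 of the paper. -/
theorem statement14 (d : ℕ) (hd : 2 ≤ d) :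
    ∃ C : ℝ, 0 < C ∧ ∀ n : ℕ, ∃ L : Finset (Set (Pt d)),
      (∀ l ∈ L, IsLine l) ∧ (L.card : ℝ) ≤ C ^ n ∧
      ∀ l : Set (Pt d), IsLine l → (l ∩ unitCube d).Nonempty →
        (¬ ∃ (j : Fin d) (m : ℤ),
          l ⊆ {x : Pt d | x j = (m : ℝ) * (2:ℝ) ^ (-(n:ℤ))}) →
        ∃ l' ∈ L, ∀ Q : Set (Pt d), IsDyadicCube d n Q →
          μH[1] (l ∩ Q) ≤ μH[1] (l' ∩ Q) +
            ENNReal.ofReal (C * (8:ℝ) ^ (-(n:ℤ))) := by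
  have hd0 : (2 : ℝ) ≤ d := by exact_mod_cast hd
  have hC : (8 * (d : ℝ) ^ 2) ≤ 144 ^ d * 144 ^ d + 8 * (d : ℝ) ^ 2 :=
    le_add_of_nonneg_left (by positivity)
  refine ⟨144 ^ d * 144 ^ d + 8 * (d : ℝ) ^ 2, by positivity, fun n => ?_⟩
  rcases eq_or_ne n 0 with rfl | hn
  · let e : Pt d := EuclideanSpace.single ⟨0, by omega⟩ 1
    refine ⟨{paramLine 0 e}, ?_, by simp, fun l hl _ _ => ⟨_, Finset.mem_singleton_self _, ?_⟩⟩
    · intro l hl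
      rw [Finset.mem_singleton.1 hl]
      exact ⟨0, e, by simp [e], rfl⟩
    · rintro Q ⟨m, hm, rfl⟩
      refine (hausdorffMeasure_inter_unitCube_le hl (dyadicCube_subset_unitCube hm)).trans
        (le_add_left (ENNReal.ofReal_le_ofReal ?_))
      simp only [Nat.cast_zero, neg_zero, zpow_zero, mul_one]
      nlinarith
  · refine ⟨gridLines d n, fun l => isLine_of_mem_gridLines, ?_, fun l hl hne h => ?_⟩
    · calc ((gridLines d n).card : ℝ) ≤ (144 ^ d * 144 ^ d) ^ n := by
            exact_mod_cast card_gridLines_le d hn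
        _ ≤ _ := by
          gcongr
          exact le_add_of_nonneg_right (by positivity)
    · obtain ⟨i, a, v, hai, hvi, hv, rfl⟩ := hl.exists_normalized
      obtain ⟨l', hl', hQ⟩ := exists_mem_gridLines n hai hvi hv hne h
      refine ⟨l', hl', fun Q hQd => (hQ Q hQd).trans ?_⟩
      gcongr
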